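/- Let P(λ) = A_m λ^m + ⋯ + A_1 λ + A_0 be an n×n complex matrix polynomial with det A_m ≠ 0 and nm ≥ 2, and let λ_1, …, λ_{nm} be the roots of det P(λ) with multiplicity. If λ_i is a simple root with unit right and left eigenvectors x_i, y_i ∈ ℂ^n, then min_{j ≠ i} |λ_j − λ_i| ≤ ( |y_i* P'(λ_i) x_i| · ‖adj(P(λ_i))‖ / |det A_m| )^{1/(nm−1)}. -/

import Mathlib

noncomputable section

open Matrix

/-- Euclidean norm of a complex vector. -/
def enorm2 {n : ℕ} (x : Fin n → ℂ) : ℝ := Real.sqrt (∑ i, ‖x i‖ ^ 2)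

/-- Spectral norm: the operator norm induced by the Euclidean vector norm. -/
def specNorm {n : ℕ} (A : Matrix (Fin n) (Fin n) ℂ) : ℝ :=
  sSup {r : ℝ | ∃ x : Fin n → ℂ, enorm2 x = 1 ∧ r = enorm2 (A.mulVec x)}

/-- Smallest singular value: the minimum of `‖A x‖` over Euclidean-unit vectors `x`. -/
def sminSV {n : ℕ} (A : Matrix (Fin n) (Fin n) ℂ) : ℝ :=
  sInf {r : ℝ | ∃ x : Fin n → ℂ, enorm2 x = 1 ∧ r = enorm2 (A.mulVec x)}

/-- Evaluation of the matrix polynomial `P(z) = ∑ A_j z^j`. -/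
def evalP {n m : ℕ} (A : Fin (m+1) → Matrix (Fin n) (Fin n) ℂ) (z : ℂ) :
    Matrix (Fin n) (Fin n) ℂ :=
  ∑ j : Fin (m+1), z ^ (j : ℕ) • A j

/-- Derivative `P'(z) = ∑_{j≥1} j A_j z^(j-1)`. -/
def derivP {n m : ℕ} (A : Fin (m+1) → Matrix (Fin n) (Fin n) ℂ) (z : ℂ) :
    Matrix (Fin n) (Fin n) ℂ :=
  ∑ j : Fin (m+1), (((j : ℕ) : ℂ) * z ^ ((j : ℕ) - 1)) • A j

/-- The scalar polynomial `det P(λ)`. -/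
def detPoly {n m : ℕ} (A : Fin (m+1) → Matrix (Fin n) (Fin n) ℂ) : Polynomial ℂ :=
  (Matrix.of fun i k => ∑ j : Fin (m+1), Polynomial.C (A j i k) * Polynomial.X ^ (j : ℕ)).det

/-- The weight polynomial `w(t) = ∑ w_j t^j`. -/
def wval {m : ℕ} (w : Fin (m+1) → ℝ) (t : ℝ) : ℝ := ∑ j : Fin (m+1), w j * t ^ (j : ℕ)

theorem aux_enorm2 {n : ℕ} (x : Fin n → ℂ) : enorm2 x = ‖WithLp.toLp 2 x‖ := by
  rw [EuclideanSpace.norm_eq]; rfl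

theorem aux_le_specNorm {n : ℕ} (A : Matrix (Fin n) (Fin n) ℂ) (x : Fin n → ℂ)
    (hx : enorm2 x = 1) : enorm2 (A.mulVec x) ≤ specNorm A := by
  apply le_csSup
  · refine ⟨‖Matrix.toEuclideanCLM (n := Fin n) (𝕜 := ℂ) A‖, ?_⟩
    rintro r ⟨z, hz, rfl⟩
    have := (Matrix.toEuclideanCLM (n := Fin n) (𝕜 := ℂ) A).le_opNorm (WithLp.toLp 2 z)
    rw [← aux_enorm2 z, hz, mul_one] at this
    rw [aux_enorm2]
    simpa using this
  · exact ⟨x, hx, rfl⟩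

theorem aux_enorm2_smul {n : ℕ} (c : ℂ) (x : Fin n → ℂ) : enorm2 (c • x) = ‖c‖ * enorm2 x := by
  rw [aux_enorm2, aux_enorm2, WithLp.toLp_smul, norm_smul]

theorem aux_star_dot {n : ℕ} (y : Fin n → ℂ) (hy : enorm2 y = 1) : star y ⬝ᵥ y = 1 := by
  have h : ∑ i, ‖y i‖ ^ 2 = 1 := by
    unfold enorm2 at hy
    exact Real.sqrt_eq_one.mp hy
  have : star y ⬝ᵥ y = ((∑ i, ‖y i‖ ^ 2 : ℝ) : ℂ) := by
    simp only [dotProduct, Pi.star_apply]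
    push_cast
    refine Finset.sum_congr rfl fun i _ => ?_
    exact RCLike.conj_mul (y i)
  rw [this, h]; simp

theorem aux_det_derivative {n : ℕ} (M : Matrix (Fin n) (Fin n) (Polynomial ℂ)) :
    Polynomial.derivative M.det
      = (M.adjugate * M.map Polynomial.derivative).trace := by
  have h1 : ∀ i, (M.adjugate * M.map Polynomial.derivative) i i
      = (M.updateCol i (fun k => Polynomial.derivative (M k i))).det := by
    intro i
    rw [← cramer_apply, cramer_eq_adjugate_mulVec]
    rfl
  simp only [Matrix.trace, Matrix.diag, h1, det_apply', map_sum]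
  rw [Finset.sum_comm]
  refine Finset.sum_congr rfl fun σ _ => ?_
  rw [Polynomial.derivative_intCast_mul, Polynomial.derivative_prod_finset, Finset.mul_sum]
  refine Finset.sum_congr rfl fun i _ => ?_
  congr 1
  rw [← Finset.prod_erase_mul _ _ (Finset.mem_univ i), updateCol_self]
  congr 1
  refine Finset.prod_congr rfl fun j hj => ?_
  rw [updateCol_ne (Finset.ne_of_mem_erase hj)]

theorem aux_ker {n : ℕ} (M : Matrix (Fin n) (Fin n) ℂ) (a b : Fin n)
    (hab : M.adjugate a b ≠ 0) (w : Fin n → ℂ) (hw : M *ᵥ w = 0) (ha : w a = 0) : w = 0 := by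
  by_contra hne
  apply hab
  rw [adjugate_apply, ← Matrix.exists_mulVec_eq_zero_iff]
  refine ⟨w, hne, ?_⟩
  ext k
  by_cases hk : k = b
  · subst hk
    simp [mulVec, ha]
  · have := congrFun hw k
    simpa [mulVec, updateRow_ne hk] using this

theorem aux_ker2 {n : ℕ} (M : Matrix (Fin n) (Fin n) ℂ) (h : M.adjugate ≠ 0)
    (x u : Fin n → ℂ) (hx : M *ᵥ x = 0) (hx0 : x ≠ 0) (hu : M *ᵥ u = 0) :
    ∃ c : ℂ, u = c • x := by
  obtain ⟨a, b, hab⟩ : ∃ a b, M.adjugate a b ≠ 0 := by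
    by_contra! hc
    exact h (by ext a b; exact hc a b)
  have hxa : x a ≠ 0 := fun h0 => hx0 (aux_ker M a b hab x hx h0)
  refine ⟨u a / x a, ?_⟩
  have := aux_ker M a b hab (u - (u a / x a) • x)
    (by rw [mulVec_sub, mulVec_smul, hx, hu]; simp) (by simp [hxa])
  exact sub_eq_zero.mp this

theorem aux_adj {n : ℕ} (M : Matrix (Fin n) (Fin n) ℂ) (h : M.adjugate ≠ 0)
    (hdet : M.det = 0) (x y : Fin n → ℂ) (hx : M *ᵥ x = 0) (hx0 : x ≠ 0)
    (hy : y ᵥ* M = 0) (hy0 : y ≠ 0) :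
    ∃ c : ℂ, M.adjugate = c • vecMulVec x y := by
  have h1 : ∀ k, ∃ d : ℂ, M.adjugate.col k = d • x := by
    intro k
    apply aux_ker2 M h x _ hx hx0
    have := M.mul_adjugate
    rw [hdet, zero_smul] at this
    ext j
    exact congrFun (congrFun this j) k
  choose d hd using h1
  have hd' : ∀ j k, M.adjugate j k = d k * x j := fun j k => congrFun (hd k) j
  obtain ⟨a, ha⟩ : ∃ a, x a ≠ 0 := Function.ne_iff.mp hx0
  have h2 : Mᵀ *ᵥ d = 0 := by
    have := M.adjugate_mul
    rw [hdet, zero_smul] at this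
    ext k
    have h3 := congrFun (congrFun this a) k
    simp only [Matrix.mul_apply, hd', Matrix.zero_apply] at h3
    have h4 : x a * (Mᵀ *ᵥ d) k = 0 := by
      rw [← h3]
      simp only [mulVec, dotProduct, transpose_apply, Finset.mul_sum]
      exact Finset.sum_congr rfl fun _ _ => by ring
    exact (mul_eq_zero.mp h4).resolve_left ha
  obtain ⟨c, hc⟩ := aux_ker2 Mᵀ (by rw [← adjugate_transpose]; simpa using h) y d
    (by rw [mulVec_transpose, hy]) hy0 h2
  refine ⟨c, ?_⟩
  ext j k
  rw [hd', hc]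
  simp [vecMulVec_apply]
  ring

theorem aux_ne {n : ℕ} (x : Fin n → ℂ) (hx : enorm2 x = 1) : x ≠ 0 := by
  rintro rfl
  simp [enorm2] at hx

theorem aux_deriv {n m : ℕ} (A : Fin (m+1) → Matrix (Fin n) (Fin n) ℂ) (z : ℂ) :
    (Polynomial.derivative (detPoly A)).eval z
      = ((evalP A z).adjugate * derivP A z).trace := by
  unfold detPoly
  rw [aux_det_derivative, ← Polynomial.coe_evalRingHom, ← AddMonoidHom.coe_coe,
    AddMonoidHom.map_trace]
  simp only [AddMonoidHom.coe_coe]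
  rw [Matrix.map_mul, ← RingHom.mapMatrix_apply, RingHom.map_adjugate]
  congr 3
  · ext a b
    simp [evalP, Matrix.sum_apply, Polynomial.eval_finsetSum]
    exact Finset.sum_congr rfl fun _ _ => by ring
  · ext a b
    simp [derivP, Matrix.sum_apply, Polynomial.eval_finsetSum]
    exact Finset.sum_congr rfl fun _ _ => by
      rw [Polynomial.derivative_X_pow]
      simp
      ring

theorem aux_det {n m : ℕ} (A : Fin (m+1) → Matrix (Fin n) (Fin n) ℂ) (z : ℂ) :
    (detPoly A).eval z = (evalP A z).det := by
  unfold detPoly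
  rw [← Polynomial.coe_evalRingHom, RingHom.map_det]
  congr 1
  ext a b
  simp [evalP, Matrix.sum_apply, Polynomial.eval_finsetSum]
  exact Finset.sum_congr rfl fun _ _ => by ring

/-- Corollary 5.5, first part: for a simple eigenvalue `λ_i` of `P`,
`min_{j ≠ i} |λ_j − λ_i| ≤ (|y_i* P'(λ_i) x_i| ‖adj(P(λ_i))‖ / |det A_m|)^{1/(nm−1)}`. -/
theorem stmt5 {n m : ℕ} (hnm : 2 ≤ n * m)
    (A : Fin (m+1) → Matrix (Fin n) (Fin n) ℂ)
    (hAm : (A (Fin.last m)).det ≠ 0)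
    (lam : Fin (n * m) → ℂ)
    (hfact : detPoly A =
      Polynomial.C ((A (Fin.last m)).det) *
        ∏ j : Fin (n * m), (Polynomial.X - Polynomial.C (lam j)))
    (i : Fin (n * m)) (hsimple : ∀ j, j ≠ i → lam j ≠ lam i)
    (x y : Fin n → ℂ)
    (hx1 : enorm2 x = 1) (hy1 : enorm2 y = 1)
    (hx : (evalP A (lam i)).mulVec x = 0)
    (hy : Matrix.vecMul (star y) (evalP A (lam i)) = 0) :
    (Finset.univ.erase i).inf'
        (by
          rw [← Finset.card_pos, Finset.card_erase_of_mem (Finset.mem_univ i),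
            Finset.card_univ, Fintype.card_fin]
          omega)
        (fun j => ‖lam j - lam i‖) ≤
      (‖star y ⬝ᵥ (derivP A (lam i)).mulVec x‖ *
          specNorm (Matrix.adjugate (evalP A (lam i))) /
          ‖(A (Fin.last m)).det‖) ^ (1 / ((n * m : ℝ) - 1)) := by
  have hx0 := aux_ne x hx1
  have hy0 : star y ≠ 0 := by simpa using aux_ne y hy1
  have hdet : (evalP A (lam i)).det = 0 := Matrix.exists_mulVec_eq_zero_iff.mp ⟨x, hx0, hx⟩
  have hD : (Polynomial.derivative (detPoly A)).eval (lam i)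
      = (A (Fin.last m)).det * ∏ j ∈ Finset.univ.erase i, (lam i - lam j) := by
    rw [hfact, ← Finset.mul_prod_erase _ _ (Finset.mem_univ i)]
    simp [Polynomial.eval_prod]
  have hprod : ∏ j ∈ Finset.univ.erase i, (lam i - lam j) ≠ 0 :=
    Finset.prod_ne_zero_iff.mpr fun j hj =>
      sub_ne_zero.mpr (hsimple j (Finset.ne_of_mem_erase hj)).symm
  have hadj : (evalP A (lam i)).adjugate ≠ 0 := by
    intro h0
    rw [aux_deriv, h0, zero_mul, Matrix.trace_zero] at hD
    exact mul_ne_zero hAm hprod hD.symm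
  obtain ⟨c, hc⟩ := aux_adj _ hadj hdet x (star y) hx hx0 hy hy0
  have hcs : ‖c‖ ≤ specNorm (evalP A (lam i)).adjugate := by
    have h := aux_le_specNorm (evalP A (lam i)).adjugate y hy1
    have h2 : (evalP A (lam i)).adjugate *ᵥ y = c • x := by
      rw [hc, smul_mulVec, vecMulVec_mulVec, aux_star_dot y hy1]
      simp
    rwa [h2, aux_enorm2_smul, hx1, mul_one] at h
  have htr : (A (Fin.last m)).det * ∏ j ∈ Finset.univ.erase i, (lam i - lam j)
      = c * (star y ⬝ᵥ (derivP A (lam i)).mulVec x) := by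
    rw [← hD, aux_deriv, hc, smul_mul, Matrix.trace_smul, vecMulVec_mul, trace_vecMulVec,
      smul_eq_mul, dotProduct_mulVec, dotProduct_comm]
  have hdpos : 0 < ‖(A (Fin.last m)).det‖ := norm_pos_iff.mpr hAm
  have hbound : ∏ j ∈ Finset.univ.erase i, ‖lam j - lam i‖ ≤
      ‖star y ⬝ᵥ (derivP A (lam i)).mulVec x‖ *
          specNorm (Matrix.adjugate (evalP A (lam i))) / ‖(A (Fin.last m)).det‖ := by
    rw [le_div_iff₀ hdpos]
    have h := congrArg norm htr
    rw [norm_mul, norm_mul, norm_prod] at h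
    simp_rw [norm_sub_rev (lam i)] at h
    rw [mul_comm, h, mul_comm]
    gcongr
  set μ := (Finset.univ.erase i).inf' _ (fun j => ‖lam j - lam i‖) with hμ
  have hμ0 : 0 ≤ μ := Finset.le_inf' _ _ fun j _ => norm_nonneg _
  have hpow : μ ^ (n * m - 1) ≤ ∏ j ∈ Finset.univ.erase i, ‖lam j - lam i‖ := by
    have hcard : (Finset.univ.erase i).card = n * m - 1 := by
      rw [Finset.card_erase_of_mem (Finset.mem_univ i), Finset.card_univ, Fintype.card_fin]
    rw [← hcard, ← Finset.prod_const]
    exact Finset.prod_le_prod (fun _ _ => hμ0) fun j hj => Finset.inf'_le _ hj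
  have hcast : ((n * m : ℝ) - 1) = ((n * m - 1 : ℕ) : ℝ) := by
    rw [Nat.cast_sub (by omega)]; push_cast; ring
  rw [hcast, one_div]
  calc μ = (μ ^ (n * m - 1)) ^ (((n * m - 1 : ℕ) : ℝ)⁻¹) :=
        (Real.pow_rpow_inv_natCast hμ0 (by omega)).symm
    _ ≤ _ := Real.rpow_le_rpow (by positivity) (hpow.trans hbound) (by positivity)
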